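/- arXiv:2105.08348 — 2 statements merged into one kernel-verified Lean document; each statement's English description precedes it below -/
import Mathlib

section
/- Let ū be a global minimizer of the convex clustering objective f, and let i, j be indices with ū_i ≠ ū_j. Then the distance between the corresponding ball centers satisfies ‖c(i) − c(j)‖ ≥ ‖ū_i − ū_j‖ + λ·(n(i) + n(j)), and in particular ‖c(i) − c(j)‖ > λ·(n(i) + n(j)). -/
open scoped RealInnerProductSpace Classical

/-- The convex clustering objective:
`f(u) = (1/2)·Σ_i ‖u_i − x_i‖² + λ·Σ_{j<i} ‖u_i − u_j‖`. -/
noncomputable def ccObj {d n : ℕ} (x : Fin n → EuclideanSpace ℝ (Fin d)) (lam : ℝ)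
    (u : Fin n → EuclideanSpace ℝ (Fin d)) : ℝ :=
  (1 / 2) * ∑ i, ‖u i - x i‖ ^ 2 + lam * ∑ i, ∑ j ∈ Finset.Iio i, ‖u i - u j‖

/-- `E_i = Σ_{j : u_j ≠ u_i} (u_i − u_j)/‖u_i − u_j‖`. -/
noncomputable def ccE {d n : ℕ} (u : Fin n → EuclideanSpace ℝ (Fin d)) (i : Fin n) :
    EuclideanSpace ℝ (Fin d) :=
  ∑ j ∈ Finset.univ.filter (fun j => u j ≠ u i), ‖u i - u j‖⁻¹ • (u i - u j)

/-- The cardinality `n(i)` of the cluster of index `i`. -/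
noncomputable def ccCard {d n : ℕ} (u : Fin n → EuclideanSpace ℝ (Fin d)) (i : Fin n) : ℕ :=
  (Finset.univ.filter fun j => u j = u i).card

/-- The bounding-ball center `c(i) = u_i + λ·E_i`. -/
noncomputable def ccCenter {d n : ℕ} (u : Fin n → EuclideanSpace ℝ (Fin d)) (lam : ℝ)
    (i : Fin n) : EuclideanSpace ℝ (Fin d) :=
  u i + lam • ccE u i

/-- The bounding-ball radius `r(i) = λ·(n(i) − 1)`. -/
noncomputable def ccRadius {d n : ℕ} (u : Fin n → EuclideanSpace ℝ (Fin d)) (lam : ℝ)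
    (i : Fin n) : ℝ :=
  lam * ((ccCard u i : ℝ) - 1)

theorem inner_inv_norm_smul_self {E : Type*} [NormedAddCommGroup E]
    [InnerProductSpace ℝ E] (a : E) : ⟪‖a‖⁻¹ • a, a⟫ = ‖a‖ := by
  rw [real_inner_smul_left, real_inner_self_eq_norm_sq, sq, ← mul_assoc]
  exact inv_mul_mul_self ‖a‖

/-- The normalization map `a ↦ a / ‖a‖`, being a subgradient of the norm, is monotone. -/
theorem inner_normalize_sub_normalize_nonneg {E : Type*} [NormedAddCommGroup E]
    [InnerProductSpace ℝ E] (a b : E) :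
    0 ≤ ⟪‖a‖⁻¹ • a - ‖b‖⁻¹ • b, a - b⟫ := by
  have cross (v w : E) : ⟪‖v‖⁻¹ • v, w⟫ ≤ ‖w‖ := by
    rw [real_inner_smul_left]
    calc ‖v‖⁻¹ * ⟪v, w⟫ ≤ ‖v‖⁻¹ * (‖v‖ * ‖w‖) := by
          gcongr
          exact real_inner_le_norm v w
      _ = (‖v‖⁻¹ * ‖v‖) * ‖w‖ := by ring
      _ ≤ 1 * ‖w‖ := by
          gcongr
          exact inv_mul_le_one
      _ = ‖w‖ := one_mul _
  rw [inner_sub_left, inner_sub_right, inner_sub_right,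
    inner_inv_norm_smul_self, inner_inv_norm_smul_self]
  linarith [cross a b, cross b a]

/-- The restriction to `u j ≠ u i` in `ccE` may be dropped, as the other terms vanish. -/
theorem ccE_eq_sum {d n : ℕ} (u : Fin n → EuclideanSpace ℝ (Fin d)) (i : Fin n) :
    ccE u i = ∑ j, ‖u i - u j‖⁻¹ • (u i - u j) := by
  unfold ccE
  refine Finset.sum_subset (Finset.filter_subset _ _) fun j _ hj => ?_
  have h : u j = u i := by simpa using hj
  simp [h]

theorem ccCard_eq_sum {d n : ℕ} (u : Fin n → EuclideanSpace ℝ (Fin d)) (i : Fin n) :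
    (ccCard u i : ℝ) = ∑ k, if u k = u i then 1 else 0 := by
  simp [ccCard]

/-- Every point of the clusters of `i` and `j` contributes `‖u i - u j‖` to the inner product,
and the other points contribute a nonnegative amount. -/
theorem ccCard_add_ccCard_mul_norm_le_inner {d n : ℕ} (u : Fin n → EuclideanSpace ℝ (Fin d))
    (i j : Fin n) (hij : u i ≠ u j) :
    ((ccCard u i : ℝ) + ccCard u j) * ‖u i - u j‖ ≤ ⟪ccE u i - ccE u j, u i - u j⟫ := by
  rw [ccE_eq_sum, ccE_eq_sum, ccCard_eq_sum, ccCard_eq_sum, ← Finset.sum_add_distrib,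
    ← Finset.sum_sub_distrib, sum_inner, Finset.sum_mul]
  refine Finset.sum_le_sum fun k _ => ?_
  by_cases hi : u k = u i
  · have h : -(‖u j - u i‖⁻¹ • (u j - u i)) = ‖u i - u j‖⁻¹ • (u i - u j) := by
      rw [norm_sub_rev, ← smul_neg, neg_sub]
    simp only [hi, hij, if_true, if_false, sub_self, smul_zero, zero_sub, h,
      inner_inv_norm_smul_self]
    simp
  · by_cases hj : u k = u j
    · simp only [hj, hij.symm, if_true, if_false, sub_self, smul_zero, sub_zero,
        inner_inv_norm_smul_self]
      simp
    · have h := inner_normalize_sub_normalize_nonneg (u i - u k) (u j - u k)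
      rw [sub_sub_sub_cancel_right] at h
      simpa [hi, hj] using h

/-- Distance between ball centers of distinct clusters:
`‖c(i) − c(j)‖ ≥ ‖ū_i − ū_j‖ + λ(n(i) + n(j)) > λ(n(i) + n(j))`. -/
theorem convex_clustering_center_separation {d n : ℕ} (hd : 0 < d) (hn : 0 < n)
    (x : Fin n → EuclideanSpace ℝ (Fin d)) (lam : ℝ) (hlam : 0 < lam)
    (ubar : Fin n → EuclideanSpace ℝ (Fin d))
    (hmin : ∀ u : Fin n → EuclideanSpace ℝ (Fin d), ccObj x lam ubar ≤ ccObj x lam u)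
    (i j : Fin n) (hij : ubar i ≠ ubar j) :
    ‖ccCenter ubar lam i - ccCenter ubar lam j‖ ≥
        ‖ubar i - ubar j‖ + lam * ((ccCard ubar i : ℝ) + (ccCard ubar j : ℝ)) ∧
      ‖ccCenter ubar lam i - ccCenter ubar lam j‖ >
        lam * ((ccCard ubar i : ℝ) + (ccCard ubar j : ℝ)) := by
  have hpos : 0 < ‖ubar i - ubar j‖ := norm_pos_iff.mpr (sub_ne_zero.mpr hij)
  have key : ‖ubar i - ubar j‖ + lam * ((ccCard ubar i : ℝ) + (ccCard ubar j : ℝ)) ≤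
      ‖ccCenter ubar lam i - ccCenter ubar lam j‖ := by
    refine le_of_mul_le_mul_right ?_ hpos
    refine le_trans ?_ (real_inner_le_norm _ _)
    have hdiff : ccCenter ubar lam i - ccCenter ubar lam j =
        (ubar i - ubar j) + lam • (ccE ubar i - ccE ubar j) := by
      unfold ccCenter
      module
    rw [hdiff, inner_add_left, real_inner_smul_left, real_inner_self_eq_norm_sq]
    have h := mul_le_mul_of_nonneg_left
      (ccCard_add_ccCard_mul_norm_le_inner ubar i j hij) hlam.le
    linarith
  exact ⟨key, by linarith⟩
end

section
/- (Lower bound on λ for nontrivial solutions.) Let ū be a global minimizer of the convex clustering objective f, and suppose some cluster V = {j : ū_j = ū_i} has cardinality q ≥ 2. Then min_{p≠p'} ‖x_p − x_{p'}‖ ≤ λ·√(2·q·(q − 1)). -/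
open scoped RealInnerProductSpace Classical

theorem norm_add_le_of_inner {E : Type*} [NormedAddCommGroup E] [InnerProductSpace ℝ E]
    {a : E} (ha : a ≠ 0) (w : E) :
    ‖a + w‖ ≤ ‖a‖ + ⟪‖a‖⁻¹ • a, w⟫ + ‖w‖ ^ 2 / (2 * ‖a‖) := by
  have hpos : 0 < ‖a‖ := norm_pos_iff.mpr ha
  have hsq := norm_add_sq_real a w
  rw [real_inner_smul_left]
  have key : ‖a‖ + ‖a‖⁻¹ * ⟪a, w⟫ + ‖w‖ ^ 2 / (2 * ‖a‖)
      = (‖a‖ ^ 2 + ‖a + w‖ ^ 2) / (2 * ‖a‖) := by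
    rw [hsq]
    field_simp
    ring
  rw [key, le_div_iff₀ (by positivity)]
  nlinarith [sq_nonneg (‖a‖ - ‖a + w‖)]

theorem nonneg_of_forall_pos_mul_add_sq {A B : ℝ}
    (h : ∀ t : ℝ, 0 < t → 0 ≤ t * A + t ^ 2 * B) : 0 ≤ A := by
  by_contra! hA
  have hB : 0 < |B| + 1 := by positivity
  have ht : 0 < -A / (|B| + 1) := div_pos (neg_pos.mpr hA) hB
  have h1 := h _ ht
  have h2 : -A / (|B| + 1) * (|B| + 1) = -A := div_mul_cancel₀ _ hB.ne'
  nlinarith [mul_pos ht ht, mul_nonneg (mul_pos ht ht).le (sub_nonneg.mpr (le_abs_self B))]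

/-- A symmetric double sum with zero diagonal is twice its strictly lower triangular part. -/
theorem sum_sum_eq_two_mul_sum_Iio {n : ℕ} (g : Fin n → Fin n → ℝ)
    (hsymm : ∀ i j, g i j = g j i) (hdiag : ∀ i, g i i = 0) :
    ∑ i, ∑ j, g i j = 2 * ∑ i, ∑ j ∈ Finset.Iio i, g i j := by
  have hswap : ∑ i, ∑ j ∈ Finset.Ioi i, g i j = ∑ i, ∑ j ∈ Finset.Iio i, g i j := by
    rw [Finset.sum_comm' (t' := Finset.univ) (s' := fun j => Finset.Iio j) (by simp)]
    exact Finset.sum_congr rfl fun i _ => Finset.sum_congr rfl fun j _ => hsymm j i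
  rw [two_mul]
  nth_rewrite 2 [← hswap]
  rw [← Finset.sum_add_distrib]
  refine Finset.sum_congr rfl fun i _ => ?_
  have hd : Disjoint (Finset.Iio i) (Finset.Ioi i) :=
    Finset.disjoint_left.mpr fun j hj hj' =>
      lt_asymm (Finset.mem_Iio.mp hj) (Finset.mem_Ioi.mp hj')
  rw [← Finset.sum_union hd]
  symm
  refine Finset.sum_subset (Finset.subset_univ _) fun j _ hj => ?_
  have : j = i := by
    simp only [Finset.mem_union, Finset.mem_Iio, Finset.mem_Ioi, not_or, not_lt] at hj
    exact le_antisymm hj.2 hj.1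
  rw [this, hdiag]

/-- A symmetric double sum with zero diagonal, supported on the row and column of `s`. -/
theorem sum_sum_Iio_eq_sum_of_cross {n : ℕ} (g : Fin n → Fin n → ℝ)
    (hsymm : ∀ i j, g i j = g j i) (hdiag : ∀ i, g i i = 0) (s : Fin n)
    (hs : ∀ i j, i ≠ s → j ≠ s → g i j = 0) :
    ∑ i, ∑ j ∈ Finset.Iio i, g i j = ∑ j, g s j := by
  have h1 := sum_sum_eq_two_mul_sum_Iio g hsymm hdiag
  have h2 : ∑ i, ∑ j, g i j = ∑ j, g s j + ∑ j, g s j := by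
    rw [← Finset.add_sum_erase _ _ (Finset.mem_univ s)]
    congr 1
    rw [← Finset.add_sum_erase _ (fun j => g s j) (Finset.mem_univ s), hdiag, zero_add]
    refine Finset.sum_congr rfl fun i hi => ?_
    rw [Finset.sum_eq_single s (fun j _ hj => hs i j (Finset.ne_of_mem_erase hi) hj)
      (by simp), hsymm]
  linarith

theorem ccObj_update_sub {d n : ℕ} (x : Fin n → EuclideanSpace ℝ (Fin d)) (lam : ℝ)
    (u : Fin n → EuclideanSpace ℝ (Fin d)) (s : Fin n) (w : EuclideanSpace ℝ (Fin d)) :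
    ccObj x lam (Function.update u s (u s + w)) - ccObj x lam u
      = (1 / 2) * (‖u s + w - x s‖ ^ 2 - ‖u s - x s‖ ^ 2)
        + lam * ∑ j ∈ Finset.univ.erase s, (‖u s + w - u j‖ - ‖u s - u j‖) := by
  set v := Function.update u s (u s + w) with hv
  have hvs : v s = u s + w := by simp [hv]
  have hvj : ∀ j, j ≠ s → v j = u j := fun j hj => by simp [hv, hj]
  have hfid : ∑ i, ‖v i - x i‖ ^ 2 - ∑ i, ‖u i - x i‖ ^ 2
      = ‖u s + w - x s‖ ^ 2 - ‖u s - x s‖ ^ 2 := by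
    rw [← Finset.sum_sub_distrib, Finset.sum_eq_single s, hvs]
    · intro j _ hj
      rw [hvj j hj, sub_self]
    · simp
  have hpen : ∑ i, ∑ j ∈ Finset.Iio i, ‖v i - v j‖ - ∑ i, ∑ j ∈ Finset.Iio i, ‖u i - u j‖
      = ∑ j ∈ Finset.univ.erase s, (‖u s + w - u j‖ - ‖u s - u j‖) := by
    simp only [← Finset.sum_sub_distrib]
    rw [sum_sum_Iio_eq_sum_of_cross (fun i j => ‖v i - v j‖ - ‖u i - u j‖)
      (fun i j => by simp only [norm_sub_rev]) (fun i => by simp) s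
      (fun i j hi hj => by simp only [hvj i hi, hvj j hj, sub_self]),
      ← Finset.add_sum_erase _ _ (Finset.mem_univ s)]
    simp only [sub_self, norm_zero, zero_add]
    refine Finset.sum_congr rfl fun j hj => ?_
    rw [hvs, hvj j (Finset.ne_of_mem_erase hj)]
  unfold ccObj
  rw [← hfid, ← hpen]
  ring

/-- The one-sided directional derivative of the objective at a minimizer, with respect to a
single block, is nonnegative. -/
theorem ccObj_directional_nonneg {d n : ℕ} {x : Fin n → EuclideanSpace ℝ (Fin d)} {lam : ℝ}
    (hlam : 0 < lam) {u : Fin n → EuclideanSpace ℝ (Fin d)}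
    (hmin : ∀ v : Fin n → EuclideanSpace ℝ (Fin d), ccObj x lam u ≤ ccObj x lam v)
    (s : Fin n) (w : EuclideanSpace ℝ (Fin d)) :
    0 ≤ ⟪u s - x s, w⟫ + lam * (((ccCard u s : ℝ) - 1) * ‖w‖ + ⟪ccE u s, w⟫) := by
  set S := Finset.univ.filter (fun j => u j ≠ u s) with hS
  set C := (Finset.univ.filter (fun j => u j = u s)).erase s with hC
  have hcard : (C.card : ℝ) = (ccCard u s : ℝ) - 1 := by
    rw [hC, Finset.cast_card_erase_of_mem (by simp), ccCard]
  have hunion : Finset.univ.erase s = C ∪ S := by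
    ext j
    simp only [hC, hS, Finset.mem_erase, Finset.mem_union, Finset.mem_filter, Finset.mem_univ]
    by_cases hj : j = s
    · simp [hj]
    · simp [hj, em]
  have hdisj : Disjoint C S :=
    (Finset.disjoint_filter_filter_not _ _ _).mono_left (Finset.erase_subset _ _)
  refine nonneg_of_forall_pos_mul_add_sq
    (B := (1 / 2) * ‖w‖ ^ 2 + lam * ∑ j ∈ S, ‖w‖ ^ 2 / (2 * ‖u s - u j‖)) fun t ht => ?_
  have hdiff := ccObj_update_sub x lam u s (t • w)
  have hge := hmin (Function.update u s (u s + t • w))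
  have hquad : ‖u s + t • w - x s‖ ^ 2 - ‖u s - x s‖ ^ 2
      = 2 * (t * ⟪u s - x s, w⟫) + t ^ 2 * ‖w‖ ^ 2 := by
    rw [add_sub_right_comm, norm_add_sq_real, real_inner_smul_right, norm_smul, mul_pow,
      Real.norm_eq_abs, sq_abs]
    ring
  have hin : ∑ j ∈ C, (‖u s + t • w - u j‖ - ‖u s - u j‖)
      = t * (((ccCard u s : ℝ) - 1) * ‖w‖) := by
    rw [Finset.sum_congr rfl (g := fun _ => t * ‖w‖), Finset.sum_const, nsmul_eq_mul, hcard]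
    · ring
    · intro j hj
      have hj' : u j = u s := (Finset.mem_filter.mp (Finset.mem_of_mem_erase hj)).2
      rw [hj', add_sub_cancel_left, sub_self, norm_zero, sub_zero, norm_smul,
        Real.norm_of_nonneg ht.le]
  have hout : ∑ j ∈ S, (‖u s + t • w - u j‖ - ‖u s - u j‖)
      ≤ t * ⟪ccE u s, w⟫ + t ^ 2 * ∑ j ∈ S, ‖w‖ ^ 2 / (2 * ‖u s - u j‖) := by
    rw [ccE, sum_inner, Finset.mul_sum, Finset.mul_sum, ← Finset.sum_add_distrib]
    refine Finset.sum_le_sum fun j hj => ?_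
    have hne : u s - u j ≠ 0 := sub_ne_zero.mpr (Finset.mem_filter.mp hj).2.symm
    have h := norm_add_le_of_inner hne (t • w)
    rw [real_inner_smul_right, norm_smul, mul_pow, Real.norm_eq_abs, sq_abs,
      mul_div_assoc] at h
    rw [add_sub_right_comm]
    linarith
  rw [hunion, Finset.sum_union hdisj, hquad, hin] at hdiff
  have := mul_le_mul_of_nonneg_left hout hlam.le
  nlinarith

/-- At a minimizer, each data point lies in the bounding ball of its cluster. -/
theorem norm_sub_ccCenter_le {d n : ℕ} {x : Fin n → EuclideanSpace ℝ (Fin d)} {lam : ℝ}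
    (hlam : 0 < lam) {u : Fin n → EuclideanSpace ℝ (Fin d)}
    (hmin : ∀ v : Fin n → EuclideanSpace ℝ (Fin d), ccObj x lam u ≤ ccObj x lam v)
    (s : Fin n) : ‖x s - ccCenter u lam s‖ ≤ ccRadius u lam s := by
  set w := x s - ccCenter u lam s with hw
  have h := ccObj_directional_nonneg hlam hmin s w
  have hinner : ⟪u s - x s, w⟫ + lam * ⟪ccE u s, w⟫ = -‖w‖ ^ 2 := by
    rw [← real_inner_smul_left, ← inner_add_left, ← real_inner_self_eq_norm_sq,
      ← inner_neg_left]
    congr 1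
    rw [hw, ccCenter]
    abel
  have hmul : ‖w‖ * ‖w‖ ≤ ccRadius u lam s * ‖w‖ := by
    rw [ccRadius]
    linarith
  rcases (norm_nonneg w).eq_or_lt with h0 | h0
  · rw [← h0, ccRadius]
    have : 1 ≤ ccCard u s := Finset.card_pos.mpr ⟨s, by simp⟩
    have : (1 : ℝ) ≤ ccCard u s := by exact_mod_cast this
    exact mul_nonneg hlam.le (by linarith)
  · exact le_of_mul_le_mul_right hmul h0

theorem sum_sum_norm_sub_sq_le {ι E : Type*} [NormedAddCommGroup E] [InnerProductSpace ℝ E]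
    (V : Finset ι) (y : ι → E) (c : E) :
    ∑ s ∈ V, ∑ t ∈ V, ‖y s - y t‖ ^ 2 ≤ 2 * V.card * ∑ s ∈ V, ‖y s - c‖ ^ 2 := by
  have hexp : ∀ s t, ‖y s - y t‖ ^ 2
      = ‖y s - c‖ ^ 2 - 2 * ⟪y s - c, y t - c⟫ + ‖y t - c‖ ^ 2 := fun s t => by
    rw [← norm_sub_sq_real, sub_sub_sub_cancel_right]
  have hcross : ∑ s ∈ V, ∑ t ∈ V, ⟪y s - c, y t - c⟫ = ‖∑ s ∈ V, (y s - c)‖ ^ 2 := by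
    rw [← real_inner_self_eq_norm_sq, sum_inner]
    simp only [inner_sum]
  simp only [hexp, Finset.sum_add_distrib, Finset.sum_sub_distrib, ← Finset.mul_sum, hcross,
    Finset.sum_const, nsmul_eq_mul]
  nlinarith [sq_nonneg ‖∑ s ∈ V, (y s - c)‖]

/-- Points in a ball of radius `r` have minimal distance at most `r √(2q / (q - 1))`. -/
theorem card_sub_one_mul_sq_le {ι E : Type*} [NormedAddCommGroup E] [InnerProductSpace ℝ E]
    {V : Finset ι} (hV : V.Nonempty) {y : ι → E} {c : E} {r m : ℝ} (hm : 0 ≤ m)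
    (hr : ∀ s ∈ V, ‖y s - c‖ ≤ r)
    (hsep : ∀ s ∈ V, ∀ t ∈ V, s ≠ t → m ≤ ‖y s - y t‖) :
    ((V.card : ℝ) - 1) * m ^ 2 ≤ 2 * V.card * r ^ 2 := by
  have hpos : (0 : ℝ) < V.card := by exact_mod_cast hV.card_pos
  have hupper : ∑ s ∈ V, ‖y s - c‖ ^ 2 ≤ V.card * r ^ 2 := by
    rw [← nsmul_eq_mul]
    exact Finset.sum_le_card_nsmul _ _ _ fun s hs =>
      pow_le_pow_left₀ (norm_nonneg _) (hr s hs) 2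
  have hlower : V.card * (((V.card : ℝ) - 1) * m ^ 2) ≤ ∑ s ∈ V, ∑ t ∈ V, ‖y s - y t‖ ^ 2 := by
    rw [← nsmul_eq_mul]
    refine Finset.card_nsmul_le_sum _ _ _ fun s hs => ?_
    rw [← Finset.add_sum_erase _ _ hs, sub_self, norm_zero, zero_pow two_ne_zero, zero_add,
      ← Finset.cast_card_erase_of_mem hs, ← nsmul_eq_mul]
    exact Finset.card_nsmul_le_sum _ _ _ fun t ht =>
      pow_le_pow_left₀ hm (hsep s hs t (Finset.mem_of_mem_erase ht)
        (Finset.ne_of_mem_erase ht).symm) 2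
  have h := sum_sum_norm_sub_sq_le V y c
  have h' := mul_le_mul_of_nonneg_left hupper (by positivity : (0 : ℝ) ≤ 2 * V.card)
  refine le_of_mul_le_mul_left ?_ hpos
  linarith

/-- Lower bound on `λ` for nontrivial solutions: if some cluster has size `q ≥ 2`, then
the minimum pairwise distance of the data satisfies
`min_{p≠p'} ‖x_p − x_{p'}‖ ≤ λ·√(2q(q−1))`. -/
theorem convex_clustering_lambda_lower_bound {d n : ℕ} (hd : 0 < d) (hn : 2 ≤ n)
    (x : Fin n → EuclideanSpace ℝ (Fin d)) (lam : ℝ) (hlam : 0 < lam)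
    (ubar : Fin n → EuclideanSpace ℝ (Fin d))
    (hmin : ∀ u : Fin n → EuclideanSpace ℝ (Fin d), ccObj x lam ubar ≤ ccObj x lam u)
    (i : Fin n) (hq : 2 ≤ ccCard ubar i) :
    ∃ p p' : Fin n, p ≠ p' ∧
      (∀ s s' : Fin n, s ≠ s' → ‖x p - x p'‖ ≤ ‖x s - x s'‖) ∧
      ‖x p - x p'‖ ≤ lam * Real.sqrt (2 * (ccCard ubar i : ℝ) * ((ccCard ubar i : ℝ) - 1)) := by
  obtain ⟨⟨p, p'⟩, hp, hpmin⟩ := Finset.exists_min_image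
    (Finset.univ.filter fun a : Fin n × Fin n => a.1 ≠ a.2) (fun a => ‖x a.1 - x a.2‖)
    ⟨(⟨0, by omega⟩, ⟨1, by omega⟩), by simp⟩
  have hsep : ∀ s s' : Fin n, s ≠ s' → ‖x p - x p'‖ ≤ ‖x s - x s'‖ := fun s s' h =>
    hpmin (s, s') (by simpa using h)
  refine ⟨p, p', (Finset.mem_filter.mp hp).2, hsep, ?_⟩
  have hball : ∀ s ∈ Finset.univ.filter (fun j => ubar j = ubar i),
      ‖x s - ccCenter ubar lam i‖ ≤ ccRadius ubar lam i := fun s hs => by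
    have hs' : ubar s = ubar i := (Finset.mem_filter.mp hs).2
    have h := norm_sub_ccCenter_le hlam hmin s
    simp only [ccCenter, ccRadius, ccCard, ccE, hs'] at h ⊢
    exact h
  have hbound := card_sub_one_mul_sq_le ⟨i, by simp⟩ (norm_nonneg (x p - x p')) hball
    fun s _ t _ => hsep s t
  rw [← ccCard, ccRadius] at hbound
  have hq' : (2 : ℝ) ≤ ccCard ubar i := by exact_mod_cast hq
  set q : ℝ := (ccCard ubar i : ℝ)
  have hnonneg : 0 ≤ 2 * q * (q - 1) := mul_nonneg (by linarith) (by linarith)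
  refine (sq_le_sq₀ (norm_nonneg _) (mul_nonneg hlam.le (Real.sqrt_nonneg _))).mp ?_
  rw [mul_pow, Real.sq_sqrt hnonneg]
  refine le_of_mul_le_mul_left (hbound.trans_eq ?_) (by linarith : 0 < q - 1)
  ring
end
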